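/- Assume a₀₃ ≠ 0 and sin²(α)·κ₂ ≠ κ₁ (so E₁ is an immersion at (0,0)). Then the tangent plane of E₁ at (0,0) contains the vector (0,0,1), and for any nonzero w ∈ ℝ² whose image under the differential of E₁ at (0,0) is parallel to (0,0,1), the vector (0,0,1) is an asymptotic direction of the evolutoid at p = E₁(0,0), i.e. ⟨D²E₁(0,0)(w,w), ν(0,0)⟩ = 0, if and only if a₀₃·a₂₁ = (a₁₂ − κ₂(κ₂−κ₁)·tan(α))². -/

import Mathlib

noncomputable section

open Real

def dot3 (a b : Fin 3 → ℝ) : ℝ := a 0 * b 0 + a 1 * b 1 + a 2 * b 2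

def cross3 (a b : Fin 3 → ℝ) : Fin 3 → ℝ :=
  ![a 1 * b 2 - a 2 * b 1, a 2 * b 0 - a 0 * b 2, a 0 * b 1 - a 1 * b 0]

def norm3 (a : Fin 3 → ℝ) : ℝ := Real.sqrt (dot3 a a)

noncomputable def pdu {X : Type*} [NormedAddCommGroup X] [NormedSpace ℝ X]
    (f : ℝ × ℝ → X) : ℝ × ℝ → X := fun p => deriv (fun t => f (t, p.2)) p.1

noncomputable def pdv {X : Type*} [NormedAddCommGroup X] [NormedSpace ℝ X]
    (f : ℝ × ℝ → X) : ℝ × ℝ → X := fun p => deriv (fun t => f (p.1, t)) p.2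

noncomputable def pd (i j : ℕ) (f : ℝ × ℝ → ℝ) : ℝ × ℝ → ℝ :=
  (pdu (X := ℝ))^[i] ((pdv (X := ℝ))^[j] f)

def mongeSurf (f : ℝ × ℝ → ℝ) : ℝ × ℝ → Fin 3 → ℝ := fun p => ![p.1, p.2, f p]

noncomputable def unitNormal (ψ : ℝ × ℝ → Fin 3 → ℝ) : ℝ × ℝ → Fin 3 → ℝ := fun p =>
  (norm3 (cross3 (pdu ψ p) (pdv ψ p)))⁻¹ • cross3 (pdu ψ p) (pdv ψ p)

noncomputable def coefE (f : ℝ × ℝ → ℝ) : ℝ × ℝ → ℝ := fun p => 1 + (pdu f p) ^ 2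
noncomputable def coefG (f : ℝ × ℝ → ℝ) : ℝ × ℝ → ℝ := fun p => 1 + (pdv f p) ^ 2

noncomputable def kap2 (f : ℝ × ℝ → ℝ) : ℝ × ℝ → ℝ := fun p =>
  dot3 (pdv (pdv (mongeSurf f)) p) (unitNormal (mongeSurf f) p) / coefG f p

noncomputable def rfun (α : ℝ) (f : ℝ × ℝ → ℝ) : ℝ × ℝ → ℝ := fun p =>
  -(2 * Real.sqrt (coefE f p) * coefG f p) /
    (Real.cos α * pdu (coefG f) p -
      2 * Real.sin α * Real.sqrt (coefE f p) * coefG f p * kap2 f p)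

noncomputable def evolutoid (α : ℝ) (f : ℝ × ℝ → ℝ) : ℝ × ℝ → Fin 3 → ℝ := fun p =>
  mongeSurf f p +
    rfun α f p •
      ((Real.cos α / Real.sqrt (coefE f p)) • pdu (mongeSurf f) p +
        Real.sin α • unitNormal (mongeSurf f) p)

def MongeHyp (κ₁ κ₂ : ℝ) (a : ℕ → ℕ → ℝ) (f : ℝ × ℝ → ℝ) : Prop :=
  ContDiff ℝ (⊤ : ℕ∞) f ∧ f (0, 0) = 0 ∧
    pdu f (0, 0) = 0 ∧ pdv f (0, 0) = 0 ∧
    pd 2 0 f (0, 0) = κ₁ ∧ pd 1 1 f (0, 0) = 0 ∧ pd 0 2 f (0, 0) = κ₂ ∧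
    ∀ i j : ℕ, 3 ≤ i + j → i + j ≤ 4 → pd i j f (0, 0) = a i j

noncomputable def gaussK (ψ : ℝ × ℝ → Fin 3 → ℝ) : ℝ × ℝ → ℝ := fun p =>
  (dot3 (pdu (pdu ψ) p) (unitNormal ψ p) * dot3 (pdv (pdv ψ) p) (unitNormal ψ p) -
      dot3 (pdu (pdv ψ) p) (unitNormal ψ p) ^ 2) /
    (norm3 (pdu ψ p) ^ 2 * norm3 (pdv ψ p) ^ 2 - (dot3 (pdu ψ p) (pdv ψ p)) ^ 2)

def AEquivalentAt {E F : Type*} [NormedAddCommGroup E] [NormedSpace ℝ E]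
    [NormedAddCommGroup F] [NormedSpace ℝ F]
    (f : E → F) (p : E) (g : E → F) (q : E) : Prop :=
  ∃ (h : PartialHomeomorph E E) (ξ : PartialHomeomorph F F),
    p ∈ h.source ∧ h p = q ∧
    ContDiffOn ℝ (⊤ : ℕ∞) h h.source ∧ ContDiffOn ℝ (⊤ : ℕ∞) h.symm h.target ∧
    f p ∈ ξ.source ∧ ξ (f p) = g q ∧
    ContDiffOn ℝ (⊤ : ℕ∞) ξ ξ.source ∧ ContDiffOn ℝ (⊤ : ℕ∞) ξ.symm ξ.target ∧
    ∀ᶠ x in nhds p, ξ (f x) = g (h x)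

section DirectionalDerivatives

variable {X : Type*} [NormedAddCommGroup X] [NormedSpace ℝ X]

theorem hasDerivAt_pdu {f : ℝ × ℝ → X} {p : ℝ × ℝ} (h : DifferentiableAt ℝ f p) :
    HasDerivAt (fun t => f (t, p.2)) (pdu f p) p.1 := by
  have h1 : DifferentiableAt ℝ (fun t : ℝ => f (t, p.2)) p.1 :=
    DifferentiableAt.comp (g := f) p.1 h (by fun_prop)
  exact h1.hasDerivAt

theorem hasDerivAt_pdv {f : ℝ × ℝ → X} {p : ℝ × ℝ} (h : DifferentiableAt ℝ f p) :
    HasDerivAt (fun t => f (p.1, t)) (pdv f p) p.2 := by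
  have h1 : DifferentiableAt ℝ (fun t : ℝ => f (p.1, t)) p.2 :=
    DifferentiableAt.comp (g := f) p.2 h (by fun_prop)
  exact h1.hasDerivAt

theorem pdu_eq_fderiv {f : ℝ × ℝ → X} {p : ℝ × ℝ} (h : DifferentiableAt ℝ f p) :
    pdu f p = fderiv ℝ f p (1, 0) :=
  (h.hasFDerivAt.comp_hasDerivAt (f := fun t : ℝ => (t, p.2)) p.1
    ((hasDerivAt_id p.1).prodMk (hasDerivAt_const p.1 p.2))).deriv

theorem pdv_eq_fderiv {f : ℝ × ℝ → X} {p : ℝ × ℝ} (h : DifferentiableAt ℝ f p) :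
    pdv f p = fderiv ℝ f p (0, 1) :=
  (h.hasFDerivAt.comp_hasDerivAt (f := fun t : ℝ => (p.1, t)) p.2
    ((hasDerivAt_const p.2 p.1).prodMk (hasDerivAt_id p.2))).deriv

theorem ContDiffAt.eventually_differentiableAt {f : ℝ × ℝ → X} {p : ℝ × ℝ}
    (h : ContDiffAt ℝ (⊤ : ℕ∞) f p) : ∀ᶠ q in nhds p, DifferentiableAt ℝ f q := by
  have h1 : ContDiffAt ℝ 1 f p := h.of_le (by exact_mod_cast le_top)
  filter_upwards [h1.eventually (by simp)] with q hq
  exact hq.differentiableAt (by simp)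

theorem ContDiffAt.pdu_eventuallyEq {f : ℝ × ℝ → X} {p : ℝ × ℝ}
    (h : ContDiffAt ℝ (⊤ : ℕ∞) f p) :
    pdu f =ᶠ[nhds p] fun q => fderiv ℝ f q (1, 0) :=
  h.eventually_differentiableAt.mono fun _ hq => pdu_eq_fderiv hq

theorem ContDiffAt.pdv_eventuallyEq {f : ℝ × ℝ → X} {p : ℝ × ℝ}
    (h : ContDiffAt ℝ (⊤ : ℕ∞) f p) :
    pdv f =ᶠ[nhds p] fun q => fderiv ℝ f q (0, 1) :=
  h.eventually_differentiableAt.mono fun _ hq => pdv_eq_fderiv hq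

theorem ContDiffAt.fderiv_apply_const {f : ℝ × ℝ → X} {p : ℝ × ℝ}
    (h : ContDiffAt ℝ (⊤ : ℕ∞) f p) (w : ℝ × ℝ) :
    ContDiffAt ℝ (⊤ : ℕ∞) (fun q => fderiv ℝ f q w) p :=
  (h.fderiv_right (m := (⊤ : ℕ∞)) (by simp)).clm_apply contDiffAt_const

theorem ContDiffAt.pdu {f : ℝ × ℝ → X} {p : ℝ × ℝ} (h : ContDiffAt ℝ (⊤ : ℕ∞) f p) :
    ContDiffAt ℝ (⊤ : ℕ∞) (pdu f) p :=
  (h.fderiv_apply_const (1, 0)).congr_of_eventuallyEq h.pdu_eventuallyEq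

theorem ContDiffAt.pdv {f : ℝ × ℝ → X} {p : ℝ × ℝ} (h : ContDiffAt ℝ (⊤ : ℕ∞) f p) :
    ContDiffAt ℝ (⊤ : ℕ∞) (pdv f) p :=
  (h.fderiv_apply_const (0, 1)).congr_of_eventuallyEq h.pdv_eventuallyEq

theorem ContDiff.pdu {f : ℝ × ℝ → X} (h : ContDiff ℝ (⊤ : ℕ∞) f) :
    ContDiff ℝ (⊤ : ℕ∞) (pdu f) :=
  contDiff_iff_contDiffAt.2 fun _ => h.contDiffAt.pdu

theorem ContDiff.pdv {f : ℝ × ℝ → X} (h : ContDiff ℝ (⊤ : ℕ∞) f) :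
    ContDiff ℝ (⊤ : ℕ∞) (pdv f) :=
  contDiff_iff_contDiffAt.2 fun _ => h.contDiffAt.pdv

theorem Filter.EventuallyEq.pdu_eq {f g : ℝ × ℝ → X} {p : ℝ × ℝ} (h : f =ᶠ[nhds p] g) :
    pdu f p = pdu g p := by
  have hc : Filter.Tendsto (fun t : ℝ => (t, p.2)) (nhds p.1) (nhds p) :=
    Continuous.tendsto (by fun_prop : Continuous fun t : ℝ => (t, p.2)) p.1
  exact Filter.EventuallyEq.deriv_eq (hc.eventually h)

theorem Filter.EventuallyEq.pdv_eq {f g : ℝ × ℝ → X} {p : ℝ × ℝ} (h : f =ᶠ[nhds p] g) :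
    pdv f p = pdv g p := by
  have hc : Filter.Tendsto (fun t : ℝ => (p.1, t)) (nhds p.2) (nhds p) :=
    Continuous.tendsto (by fun_prop : Continuous fun t : ℝ => (p.1, t)) p.2
  exact Filter.EventuallyEq.deriv_eq (hc.eventually h)

theorem pdu_pdu_eq_fderiv {f : ℝ × ℝ → X} {p : ℝ × ℝ} (h : ContDiffAt ℝ (⊤ : ℕ∞) f p) :
    pdu (pdu f) p = fderiv ℝ (fun q => fderiv ℝ f q (1, 0)) p (1, 0) := by
  rw [h.pdu_eventuallyEq.pdu_eq,
    pdu_eq_fderiv ((h.fderiv_apply_const _).differentiableAt (by simp))]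

theorem pdu_pdv_eq_fderiv {f : ℝ × ℝ → X} {p : ℝ × ℝ} (h : ContDiffAt ℝ (⊤ : ℕ∞) f p) :
    pdu (pdv f) p = fderiv ℝ (fun q => fderiv ℝ f q (0, 1)) p (1, 0) := by
  rw [h.pdv_eventuallyEq.pdu_eq,
    pdu_eq_fderiv ((h.fderiv_apply_const _).differentiableAt (by simp))]

theorem pdv_pdu_eq_fderiv {f : ℝ × ℝ → X} {p : ℝ × ℝ} (h : ContDiffAt ℝ (⊤ : ℕ∞) f p) :
    pdv (pdu f) p = fderiv ℝ (fun q => fderiv ℝ f q (1, 0)) p (0, 1) := by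
  rw [h.pdu_eventuallyEq.pdv_eq,
    pdv_eq_fderiv ((h.fderiv_apply_const _).differentiableAt (by simp))]

theorem pdv_pdv_eq_fderiv {f : ℝ × ℝ → X} {p : ℝ × ℝ} (h : ContDiffAt ℝ (⊤ : ℕ∞) f p) :
    pdv (pdv f) p = fderiv ℝ (fun q => fderiv ℝ f q (0, 1)) p (0, 1) := by
  rw [h.pdv_eventuallyEq.pdv_eq,
    pdv_eq_fderiv ((h.fderiv_apply_const _).differentiableAt (by simp))]

theorem pdv_pdu_comm {f : ℝ × ℝ → X} {p : ℝ × ℝ} (h : ContDiffAt ℝ (⊤ : ℕ∞) f p) :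
    pdv (pdu f) p = pdu (pdv f) p := by
  have hd : DifferentiableAt ℝ (fderiv ℝ f) p :=
    (h.fderiv_right (m := (⊤ : ℕ∞)) (by simp)).differentiableAt (by simp)
  have hs : IsSymmSndFDerivAt ℝ f p := h.isSymmSndFDerivAt <| by
    rw [minSmoothness_of_isRCLikeNormedField]
    exact WithTop.coe_le_coe.2 (le_top : (2 : ℕ∞) ≤ ⊤)
  rw [pdv_pdu_eq_fderiv h, pdu_pdv_eq_fderiv h,
    fderiv_clm_apply hd (differentiableAt_const _),
    fderiv_clm_apply hd (differentiableAt_const _)]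
  simpa using hs.eq (0, 1) (1, 0)

theorem pdu_vec {x y z : ℝ × ℝ → ℝ} {p : ℝ × ℝ} (hx : DifferentiableAt ℝ x p)
    (hy : DifferentiableAt ℝ y p) (hz : DifferentiableAt ℝ z p) :
    pdu (fun q => ![x q, y q, z q]) p = ![pdu x p, pdu y p, pdu z p] := by
  refine HasDerivAt.deriv (hasDerivAt_pi.2 fun i => ?_)
  fin_cases i
  exacts [hasDerivAt_pdu hx, hasDerivAt_pdu hy, hasDerivAt_pdu hz]

theorem pdv_vec {x y z : ℝ × ℝ → ℝ} {p : ℝ × ℝ} (hx : DifferentiableAt ℝ x p)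
    (hy : DifferentiableAt ℝ y p) (hz : DifferentiableAt ℝ z p) :
    pdv (fun q => ![x q, y q, z q]) p = ![pdv x p, pdv y p, pdv z p] := by
  refine HasDerivAt.deriv (hasDerivAt_pi.2 fun i => ?_)
  fin_cases i
  exacts [hasDerivAt_pdv hx, hasDerivAt_pdv hy, hasDerivAt_pdv hz]

theorem pdu_vec_eventuallyEq {x y z : ℝ × ℝ → ℝ} {p : ℝ × ℝ}
    (hx : ContDiffAt ℝ (⊤ : ℕ∞) x p) (hy : ContDiffAt ℝ (⊤ : ℕ∞) y p)
    (hz : ContDiffAt ℝ (⊤ : ℕ∞) z p) :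
    pdu (fun q => ![x q, y q, z q]) =ᶠ[nhds p] fun q => ![pdu x q, pdu y q, pdu z q] := by
  filter_upwards [hx.eventually_differentiableAt, hy.eventually_differentiableAt,
    hz.eventually_differentiableAt] with q h1 h2 h3 using pdu_vec h1 h2 h3

theorem pdv_vec_eventuallyEq {x y z : ℝ × ℝ → ℝ} {p : ℝ × ℝ}
    (hx : ContDiffAt ℝ (⊤ : ℕ∞) x p) (hy : ContDiffAt ℝ (⊤ : ℕ∞) y p)
    (hz : ContDiffAt ℝ (⊤ : ℕ∞) z p) :
    pdv (fun q => ![x q, y q, z q]) =ᶠ[nhds p] fun q => ![pdv x q, pdv y q, pdv z q] := by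
  filter_upwards [hx.eventually_differentiableAt, hy.eventually_differentiableAt,
    hz.eventually_differentiableAt] with q h1 h2 h3 using pdv_vec h1 h2 h3

theorem fderiv_fderiv_snd_add_mul {k g : ℝ × ℝ → ℝ} {p : ℝ × ℝ}
    (hk : ContDiffAt ℝ (⊤ : ℕ∞) k p) (hg : ContDiffAt ℝ (⊤ : ℕ∞) g p) (h0 : g p = 0)
    (w w' : ℝ × ℝ) :
    fderiv ℝ (fun q => fderiv ℝ (fun q => q.2 + k q * g q) q w') p w =
      fderiv ℝ k p w * fderiv ℝ g p w' + fderiv ℝ k p w' * fderiv ℝ g p w +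
        k p * fderiv ℝ (fun q => fderiv ℝ g q w') p w := by
  have h1 : (fun q => fderiv ℝ (fun q => q.2 + k q * g q) q w') =ᶠ[nhds p]
      fun q => w'.2 + (k q * fderiv ℝ g q w' + g q * fderiv ℝ k q w') := by
    filter_upwards [hk.eventually_differentiableAt, hg.eventually_differentiableAt] with q hkq hgq
    have h := (hasFDerivAt_snd (𝕜 := ℝ) (p := q)).add (hkq.hasFDerivAt.mul hgq.hasFDerivAt)
    have h' : fderiv ℝ (fun q => q.2 + k q * g q) q = _ := h.fderiv
    rw [h']
    simp
  have hk1 := hk.differentiableAt (by simp)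
  have hg1 := hg.differentiableAt (by simp)
  have hk2 := (hk.fderiv_apply_const w').differentiableAt (by simp)
  have hg2 := (hg.fderiv_apply_const w').differentiableAt (by simp)
  have h2 := ((hk1.hasFDerivAt.mul hg2.hasFDerivAt).add
    (hg1.hasFDerivAt.mul hk2.hasFDerivAt)).const_add w'.2
  have h2' : fderiv ℝ (fun q => w'.2 + (k q * fderiv ℝ g q w' + g q * fderiv ℝ k q w')) p = _ :=
    h2.fderiv
  rw [h1.fderiv_eq, h2']
  simp [h0]
  ring

end DirectionalDerivatives

theorem pdu_mongeSurf {f : ℝ × ℝ → ℝ} (hf : ContDiff ℝ (⊤ : ℕ∞) f) :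
    pdu (mongeSurf f) = fun p => ![1, 0, pdu f p] := by
  funext p
  have h := pdu_vec (x := fun q => q.1) (y := fun q => q.2) (p := p) differentiableAt_fst
    differentiableAt_snd (hf.differentiable (by simp) p)
  have h1 : pdu (fun q : ℝ × ℝ => q.1) p = 1 := by simp [pdu]
  have h2 : pdu (fun q : ℝ × ℝ => q.2) p = 0 := by simp [pdu]
  rw [h1, h2] at h
  exact h

theorem pdv_mongeSurf {f : ℝ × ℝ → ℝ} (hf : ContDiff ℝ (⊤ : ℕ∞) f) :
    pdv (mongeSurf f) = fun p => ![0, 1, pdv f p] := by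
  funext p
  have h := pdv_vec (x := fun q => q.1) (y := fun q => q.2) (p := p) differentiableAt_fst
    differentiableAt_snd (hf.differentiable (by simp) p)
  have h1 : pdv (fun q : ℝ × ℝ => q.1) p = 0 := by simp [pdv]
  have h2 : pdv (fun q : ℝ × ℝ => q.2) p = 1 := by simp [pdv]
  rw [h1, h2] at h
  exact h

theorem pdv_pdv_mongeSurf {f : ℝ × ℝ → ℝ} (hf : ContDiff ℝ (⊤ : ℕ∞) f) :
    pdv (pdv (mongeSurf f)) = fun p => ![0, 0, pdv (pdv f) p] := by
  rw [pdv_mongeSurf hf]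
  funext p
  have h := pdv_vec (x := fun _ => 0) (y := fun _ => 1) (p := p) (differentiableAt_const _)
    (differentiableAt_const _) (hf.pdv.differentiable (by simp) p)
  have h1 (c : ℝ) : pdv (fun _ : ℝ × ℝ => c) p = 0 := by simp [pdv]
  rw [h1, h1] at h
  exact h

theorem unitNormal_mongeSurf {f : ℝ × ℝ → ℝ} (hf : ContDiff ℝ (⊤ : ℕ∞) f) (p : ℝ × ℝ) :
    unitNormal (mongeSurf f) p =
      (√(1 + pdu f p ^ 2 + pdv f p ^ 2))⁻¹ • ![-pdu f p, -pdv f p, 1] := by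
  have h : cross3 (pdu (mongeSurf f) p) (pdv (mongeSurf f) p) = ![-pdu f p, -pdv f p, 1] := by
    rw [pdu_mongeSurf hf, pdv_mongeSurf hf]
    simp [cross3]
  rw [unitNormal, h, norm3]
  congr 3
  simp [dot3]
  ring

theorem pdu_coefG {f : ℝ × ℝ → ℝ} (hf : ContDiff ℝ (⊤ : ℕ∞) f) (p : ℝ × ℝ) :
    pdu (coefG f) p = 2 * pdv f p * pdu (pdv f) p := by
  have h := ((hasDerivAt_pdu (hf.pdv.differentiable (by simp) p)).pow 2).const_add 1
  have h' : pdu (coefG f) p = _ := h.deriv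
  simpa using h'

/-- The radius function of the evolutoid divided by `√E`, in terms of the values `p = f_u`,
`q = f_v`, `s = f_vv` and `t = f_uv`. -/
def radiusQuot (α p q s t : ℝ) : ℝ :=
  -(2 * √(1 + p ^ 2) * (1 + q ^ 2)) /
    (cos α * (2 * q * t) - 2 * sin α * √(1 + p ^ 2) * (1 + q ^ 2) *
      (s * (√(1 + p ^ 2 + q ^ 2))⁻¹ / (1 + q ^ 2))) / √(1 + p ^ 2)

/-- The coefficient of `(f_u, f_v, -1)` in the evolutoid. -/
def normalCoef (α p q s t : ℝ) : ℝ :=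
  -(sin α * (radiusQuot α p q s t * √(1 + p ^ 2) * (√(1 + p ^ 2 + q ^ 2))⁻¹))

theorem hasDerivAt_sqrt_one_add_sq {p : ℝ → ℝ} {p' x : ℝ} (hp : HasDerivAt p p' x)
    (hp0 : p x = 0) : HasDerivAt (fun y => √(1 + p y ^ 2)) 0 x := by
  have h := ((hp.pow 2).const_add 1).sqrt (by simp [hp0])
  simpa [hp0] using h

theorem hasDerivAt_inv_sqrt_one_add_sq_add_sq {p q : ℝ → ℝ} {p' q' x : ℝ}
    (hp : HasDerivAt p p' x) (hq : HasDerivAt q q' x) (hp0 : p x = 0) (hq0 : q x = 0) :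
    HasDerivAt (fun y => (√(1 + p y ^ 2 + q y ^ 2))⁻¹) 0 x := by
  have h := ((((hp.pow 2).const_add 1).add (hq.pow 2)).sqrt (by simp [hp0, hq0])).fun_inv
    (by simp [hp0, hq0])
  simpa [hp0, hq0] using h

theorem hasDerivAt_radiusQuot {α : ℝ} (hs : sin α ≠ 0) {p q s t : ℝ → ℝ} {p' q' s' t' x : ℝ}
    (hp : HasDerivAt p p' x) (hq : HasDerivAt q q' x) (hS : HasDerivAt s s' x)
    (ht : HasDerivAt t t' x) (hp0 : p x = 0) (hq0 : q x = 0) (ht0 : t x = 0) (hs0 : s x ≠ 0) :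
    HasDerivAt (fun y => radiusQuot α (p y) (q y) (s y) (t y)) (-s' / (sin α * s x ^ 2)) x := by
  have hE := hasDerivAt_sqrt_one_add_sq hp hp0
  have hW := hasDerivAt_inv_sqrt_one_add_sq_add_sq hp hq hp0 hq0
  have hG : HasDerivAt (fun y => 1 + q y ^ 2) 0 x := by
    simpa [hq0] using (hq.pow 2).const_add 1
  have hD := (((hq.const_mul 2).mul ht).const_mul (cos α)).sub
    (((hE.const_mul (2 * sin α)).mul hG).mul ((hS.mul hW).div hG (by simp [hq0])))
  have h := (((hE.const_mul 2).mul hG).neg.div hD (by simp [hp0, hq0, hs, hs0])).div hE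
    (by simp [hp0])
  refine HasDerivAt.congr_deriv h ?_
  simp [hp0, hq0, ht0]
  field_simp

theorem hasDerivAt_normalCoef {α : ℝ} (hs : sin α ≠ 0) {p q s t : ℝ → ℝ} {p' q' s' t' x : ℝ}
    (hp : HasDerivAt p p' x) (hq : HasDerivAt q q' x) (hS : HasDerivAt s s' x)
    (ht : HasDerivAt t t' x) (hp0 : p x = 0) (hq0 : q x = 0) (ht0 : t x = 0) (hs0 : s x ≠ 0) :
    HasDerivAt (fun y => normalCoef α (p y) (q y) (s y) (t y)) (s' / s x ^ 2) x := by
  have h := ((((hasDerivAt_radiusQuot hs hp hq hS ht hp0 hq0 ht0 hs0).mul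
    (hasDerivAt_sqrt_one_add_sq hp hp0)).mul
    (hasDerivAt_inv_sqrt_one_add_sq_add_sq hp hq hp0 hq0)).const_mul (sin α)).neg
  refine HasDerivAt.congr_deriv h ?_
  simp [hp0, hq0]
  field_simp

theorem radiusQuot_zero {α : ℝ} (s : ℝ) : radiusQuot α 0 0 s 0 = 1 / (sin α * s) := by
  simp [radiusQuot]
  field_simp

theorem normalCoef_zero {α : ℝ} (hs : sin α ≠ 0) (s : ℝ) : normalCoef α 0 0 s 0 = -1 / s := by
  simp [normalCoef, radiusQuot_zero]
  field_simp

theorem contDiffAt_radiusQuot {α : ℝ} (hs : sin α ≠ 0) {p q s t : ℝ × ℝ → ℝ} {x : ℝ × ℝ}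
    (hp : ContDiff ℝ (⊤ : ℕ∞) p) (hq : ContDiff ℝ (⊤ : ℕ∞) q) (hS : ContDiff ℝ (⊤ : ℕ∞) s)
    (ht : ContDiff ℝ (⊤ : ℕ∞) t) (hp0 : p x = 0) (hq0 : q x = 0) (hs0 : s x ≠ 0) :
    ContDiffAt ℝ (⊤ : ℕ∞) (fun y => radiusQuot α (p y) (q y) (s y) (t y)) x := by
  unfold radiusQuot
  have hE : ContDiffAt ℝ (⊤ : ℕ∞) (fun y => √(1 + p y ^ 2)) x :=
    ContDiffAt.sqrt (by fun_prop) (by simp [hp0])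
  have hW : ContDiffAt ℝ (⊤ : ℕ∞) (fun y => (√(1 + p y ^ 2 + q y ^ 2))⁻¹) x :=
    (ContDiffAt.sqrt (by fun_prop) (by simp [hp0, hq0])).inv (by simp [hp0, hq0])
  have hSG : ContDiffAt ℝ (⊤ : ℕ∞)
      (fun y => s y * (√(1 + p y ^ 2 + q y ^ 2))⁻¹ / (1 + q y ^ 2)) x :=
    (hS.contDiffAt.mul hW).div (by fun_prop) (by simp [hq0])
  exact ContDiffAt.div (ContDiffAt.div (by fun_prop) (by fun_prop) (by simp [hp0, hq0, hs, hs0]))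
    hE (by simp [hp0])

theorem contDiffAt_normalCoef {α : ℝ} (hs : sin α ≠ 0) {p q s t : ℝ × ℝ → ℝ} {x : ℝ × ℝ}
    (hp : ContDiff ℝ (⊤ : ℕ∞) p) (hq : ContDiff ℝ (⊤ : ℕ∞) q) (hS : ContDiff ℝ (⊤ : ℕ∞) s)
    (ht : ContDiff ℝ (⊤ : ℕ∞) t) (hp0 : p x = 0) (hq0 : q x = 0) (hs0 : s x ≠ 0) :
    ContDiffAt ℝ (⊤ : ℕ∞) (fun y => normalCoef α (p y) (q y) (s y) (t y)) x := by
  unfold normalCoef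
  have hR := contDiffAt_radiusQuot hs hp hq hS ht hp0 hq0 hs0
  have hE : ContDiffAt ℝ (⊤ : ℕ∞) (fun y => √(1 + p y ^ 2)) x :=
    ContDiffAt.sqrt (by fun_prop) (by simp [hp0])
  have hW : ContDiffAt ℝ (⊤ : ℕ∞) (fun y => (√(1 + p y ^ 2 + q y ^ 2))⁻¹) x :=
    (ContDiffAt.sqrt (by fun_prop) (by simp [hp0, hq0])).inv (by simp [hp0, hq0])
  fun_prop

theorem evolutoid_eq {α : ℝ} {f l k : ℝ × ℝ → ℝ} (hf : ContDiff ℝ (⊤ : ℕ∞) f)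
    (hl : l = fun p => radiusQuot α (pdu f p) (pdv f p) (pdv (pdv f) p) (pdu (pdv f) p))
    (hk : k = fun p => normalCoef α (pdu f p) (pdv f p) (pdv (pdv f) p) (pdu (pdv f) p)) :
    evolutoid α f = fun p =>
      ![p.1 + (cos α * l p + k p * pdu f p), p.2 + k p * pdv f p,
        f p + (cos α * (l p * pdu f p) - k p)] := by
  funext p
  have hE : √(1 + pdu f p ^ 2) ≠ 0 := (Real.sqrt_pos.2 (by positivity)).ne'
  have hr : rfun α f p = l p * √(1 + pdu f p ^ 2) := by
    rw [hl]
    simp only [rfun, radiusQuot, kap2, coefE, pdu_coefG hf, pdv_pdv_mongeSurf hf,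
      unitNormal_mongeSurf hf, dot3]
    rw [div_mul_cancel₀ _ hE]
    simp [coefG]
  have hk' : k p = -(sin α * (l p * √(1 + pdu f p ^ 2) *
      (√(1 + pdu f p ^ 2 + pdv f p ^ 2))⁻¹)) := by rw [hk, hl]; rfl
  rw [evolutoid, hr, unitNormal_mongeSurf hf, pdu_mongeSurf hf, hk']
  ext i
  fin_cases i <;> simp [mongeSurf, coefE] <;> field_simp

theorem evolutoid_asymptotic_direction_condition
    (α κ₁ κ₂ : ℝ) (a : ℕ → ℕ → ℝ) (f : ℝ × ℝ → ℝ)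
    (hα : α ∈ Set.Ioo 0 (Real.pi / 2))
    (hκ : κ₂ < κ₁) (hκ₁ : κ₁ ≠ 0) (hκ₂ : κ₂ ≠ 0)
    (hf : MongeHyp κ₁ κ₂ a f)
    (ha03 : a 0 3 ≠ 0) (hne : Real.sin α ^ 2 * κ₂ ≠ κ₁) :
    (∃ w : ℝ × ℝ,
      w.1 • pdu (evolutoid α f) (0, 0) + w.2 • pdv (evolutoid α f) (0, 0) =
        ![0, 0, 1]) ∧
    ∀ w : ℝ × ℝ, w ≠ 0 →
      (∃ c : ℝ,
        w.1 • pdu (evolutoid α f) (0, 0) + w.2 • pdv (evolutoid α f) (0, 0) =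
          c • ![0, 0, 1]) →
      (dot3
          (w.1 ^ 2 • pdu (pdu (evolutoid α f)) (0, 0) +
            (2 * w.1 * w.2) • pdu (pdv (evolutoid α f)) (0, 0) +
            w.2 ^ 2 • pdv (pdv (evolutoid α f)) (0, 0))
          (unitNormal (evolutoid α f) (0, 0)) = 0 ↔
        a 0 3 * a 2 1 = (a 1 2 - κ₂ * (κ₂ - κ₁) * Real.tan α) ^ 2) := by
  obtain ⟨hf, -, hu, hv, hκu, huv, hκv, ha⟩ := hf
  have hs : 0 < sin α := sin_pos_of_pos_of_lt_pi hα.1 (by linarith [hα.2, pi_pos])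
  have hc : 0 < cos α := cos_pos_of_mem_Ioo ⟨by linarith [hα.1, pi_pos], hα.2⟩
  have h12 : pdu (pdv (pdv f)) (0, 0) = a 1 2 := ha 1 2 (by norm_num) (by norm_num)
  have h03 : pdv (pdv (pdv f)) (0, 0) = a 0 3 := ha 0 3 (by norm_num) (by norm_num)
  have h21 : pdu (pdu (pdv f)) (0, 0) = a 2 1 := ha 2 1 (by norm_num) (by norm_num)
  change pdu (pdu f) (0, 0) = κ₁ at hκu
  change pdu (pdv f) (0, 0) = 0 at huv
  change pdv (pdv f) (0, 0) = κ₂ at hκv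
  have hvu : pdv (pdu f) (0, 0) = 0 := by rw [pdv_pdu_comm hf.contDiffAt, huv]
  have hS0 : pdv (pdv f) (0, 0) ≠ 0 := by rwa [hκv]
  obtain ⟨l, hl⟩ : ∃ l : ℝ × ℝ → ℝ, l = fun p =>
    radiusQuot α (pdu f p) (pdv f p) (pdv (pdv f) p) (pdu (pdv f) p) := ⟨_, rfl⟩
  obtain ⟨k, hk⟩ : ∃ k : ℝ × ℝ → ℝ, k = fun p =>
    normalCoef α (pdu f p) (pdv f p) (pdv (pdv f) p) (pdu (pdv f) p) := ⟨_, rfl⟩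
  have hls : ContDiffAt ℝ (⊤ : ℕ∞) l (0, 0) := hl ▸
    contDiffAt_radiusQuot hs.ne' hf.pdu hf.pdv hf.pdv.pdv hf.pdv.pdu hu hv hS0
  have hks : ContDiffAt ℝ (⊤ : ℕ∞) k (0, 0) := hk ▸
    contDiffAt_normalCoef hs.ne' hf.pdu hf.pdv hf.pdv.pdv hf.pdv.pdu hu hv hS0
  have hPs : ContDiffAt ℝ (⊤ : ℕ∞) (pdu f) (0, 0) := hf.pdu.contDiffAt
  have hQs : ContDiffAt ℝ (⊤ : ℕ∞) (pdv f) (0, 0) := hf.pdv.contDiffAt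
  have hl0 : l (0, 0) = 1 / (sin α * κ₂) := by
    simp only [hl, hu, hv, huv, hκv]
    exact radiusQuot_zero κ₂
  have hk0 : k (0, 0) = -1 / κ₂ := by
    simp only [hk, hu, hv, huv, hκv]
    exact normalCoef_zero hs.ne' κ₂
  have hd (g : ℝ × ℝ → ℝ) (hg : ContDiff ℝ (⊤ : ℕ∞) g) : DifferentiableAt ℝ g (0, 0) :=
    hg.differentiable (by simp) _
  have hlu : pdu l (0, 0) = -a 1 2 / (sin α * κ₂ ^ 2) := by
    have h := hasDerivAt_radiusQuot hs.ne' (hasDerivAt_pdu (hd _ hf.pdu))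
      (hasDerivAt_pdu (hd _ hf.pdv)) (hasDerivAt_pdu (hd _ hf.pdv.pdv))
      (hasDerivAt_pdu (hd _ hf.pdv.pdu)) hu hv huv hS0
    rw [h12] at h
    rw [hl, ← hκv]
    exact h.deriv
  have hlv : pdv l (0, 0) = -a 0 3 / (sin α * κ₂ ^ 2) := by
    have h := hasDerivAt_radiusQuot hs.ne' (hasDerivAt_pdv (hd _ hf.pdu))
      (hasDerivAt_pdv (hd _ hf.pdv)) (hasDerivAt_pdv (hd _ hf.pdv.pdv))
      (hasDerivAt_pdv (hd _ hf.pdv.pdu)) hu hv huv hS0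
    rw [h03] at h
    rw [hl, ← hκv]
    exact h.deriv
  have hku : pdu k (0, 0) = a 1 2 / κ₂ ^ 2 := by
    have h := hasDerivAt_normalCoef hs.ne' (hasDerivAt_pdu (hd _ hf.pdu))
      (hasDerivAt_pdu (hd _ hf.pdv)) (hasDerivAt_pdu (hd _ hf.pdv.pdv))
      (hasDerivAt_pdu (hd _ hf.pdv.pdu)) hu hv huv hS0
    rw [h12] at h
    rw [hk, ← hκv]
    exact h.deriv
  have hkv : pdv k (0, 0) = a 0 3 / κ₂ ^ 2 := by
    have h := hasDerivAt_normalCoef hs.ne' (hasDerivAt_pdv (hd _ hf.pdu))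
      (hasDerivAt_pdv (hd _ hf.pdv)) (hasDerivAt_pdv (hd _ hf.pdv.pdv))
      (hasDerivAt_pdv (hd _ hf.pdv.pdu)) hu hv huv hS0
    rw [h03] at h
    rw [hk, ← hκv]
    exact h.deriv
  have hl1 := hls.differentiableAt (by simp)
  have hk1 := hks.differentiableAt (by simp)
  have hP1 := hPs.differentiableAt (by simp)
  have hQ1 := hQs.differentiableAt (by simp)
  have hf1 := hd f hf
  obtain ⟨x, hx⟩ : ∃ x : ℝ × ℝ → ℝ, x = fun p => p.1 + (cos α * l p + k p * pdu f p) := ⟨_, rfl⟩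
  obtain ⟨y, hy⟩ : ∃ y : ℝ × ℝ → ℝ, y = fun p => p.2 + k p * pdv f p := ⟨_, rfl⟩
  obtain ⟨z, hz⟩ : ∃ z : ℝ × ℝ → ℝ,
    z = fun p => f p + (cos α * (l p * pdu f p) - k p) := ⟨_, rfl⟩
  have hxs : ContDiffAt ℝ (⊤ : ℕ∞) x (0, 0) := by rw [hx]; fun_prop
  have hys : ContDiffAt ℝ (⊤ : ℕ∞) y (0, 0) := by rw [hy]; fun_prop
  have hzs : ContDiffAt ℝ (⊤ : ℕ∞) z (0, 0) := by
    have := hf.contDiffAt (x := ((0, 0) : ℝ × ℝ))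
    rw [hz]; fun_prop
  have hE : evolutoid α f = fun p => ![x p, y p, z p] := by
    rw [hx, hy, hz]
    exact evolutoid_eq hf hl hk
  have hxu : pdu x (0, 0) = 1 + (cos α * pdu l (0, 0) + -1 / κ₂ * κ₁) := by
    have h := (hasDerivAt_id (0 : ℝ)).add (((hasDerivAt_pdu hl1).const_mul (cos α)).add
      ((hasDerivAt_pdu hk1).mul (hasDerivAt_pdu hP1)))
    rw [hx]
    refine Eq.trans (HasDerivAt.deriv h) ?_
    simp [hu, hκu, hk0]
  have hxv : pdv x (0, 0) = cos α * pdv l (0, 0) := by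
    have h := (hasDerivAt_const (0 : ℝ) (0 : ℝ)).add
      (((hasDerivAt_pdv hl1).const_mul (cos α)).add
        ((hasDerivAt_pdv hk1).mul (hasDerivAt_pdv hP1)))
    rw [hx]
    refine Eq.trans (HasDerivAt.deriv h) ?_
    simp [hu, hvu]
  have hyu : pdu y (0, 0) = 0 := by
    have h := (hasDerivAt_const (0 : ℝ) (0 : ℝ)).add
      ((hasDerivAt_pdu hk1).mul (hasDerivAt_pdu hQ1))
    rw [hy]
    refine Eq.trans (HasDerivAt.deriv h) ?_
    simp [hv, huv]
  have hyv : pdv y (0, 0) = 0 := by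
    have h := (hasDerivAt_id (0 : ℝ)).add
      ((hasDerivAt_pdv hk1).mul (hasDerivAt_pdv hQ1))
    rw [hy]
    refine Eq.trans (HasDerivAt.deriv h) ?_
    simp [hv, hκv, hk0]
    field_simp
    ring
  have hzu : pdu z (0, 0) = cos α * (1 / (sin α * κ₂) * κ₁) - a 1 2 / κ₂ ^ 2 := by
    have h := (hasDerivAt_pdu hf1).add ((((hasDerivAt_pdu hl1).mul
      (hasDerivAt_pdu hP1)).const_mul (cos α)).sub (hasDerivAt_pdu hk1))
    rw [hz]
    refine Eq.trans (HasDerivAt.deriv h) ?_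
    simp [hu, hκu, hl0, hku]
  have hzv : pdv z (0, 0) = -(a 0 3 / κ₂ ^ 2) := by
    have h := (hasDerivAt_pdv hf1).add ((((hasDerivAt_pdv hl1).mul
      (hasDerivAt_pdv hP1)).const_mul (cos α)).sub (hasDerivAt_pdv hk1))
    rw [hz]
    refine Eq.trans (HasDerivAt.deriv h) ?_
    simp [hu, hv, hvu, hkv]
  have hEu : pdu (evolutoid α f) (0, 0) = ![pdu x (0, 0), 0, pdu z (0, 0)] := by
    rw [hE, (pdu_vec_eventuallyEq hxs hys hzs).self_of_nhds]
    simp only [hyu]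
  have hEv : pdv (evolutoid α f) (0, 0) = ![pdv x (0, 0), 0, pdv z (0, 0)] := by
    rw [hE, (pdv_vec_eventuallyEq hxs hys hzs).self_of_nhds]
    simp only [hyv]
  have hdet : pdv x (0, 0) * pdu z (0, 0) - pdu x (0, 0) * pdv z (0, 0) ≠ 0 := by
    have h : pdv x (0, 0) * pdu z (0, 0) - pdu x (0, 0) * pdv z (0, 0) =
        a 0 3 * (sin α ^ 2 * κ₂ - κ₁) / (sin α ^ 2 * κ₂ ^ 3) := by
      rw [hxu, hxv, hzu, hzv, hlu, hlv]
      have hsc := sin_sq_add_cos_sq α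
      field_simp
      linear_combination (-κ₁ * κ₂) * hsc
    rw [h]
    exact div_ne_zero (mul_ne_zero ha03 (sub_ne_zero.2 hne)) (by positivity)
  have hyy (i j : ℝ × ℝ) := fderiv_fderiv_snd_add_mul hks hQs hv i j
  rw [← hy] at hyy
  have hyuu : pdu (pdu y) (0, 0) = -1 / κ₂ * a 2 1 := by
    rw [pdu_pdu_eq_fderiv hys, hyy, ← pdu_pdu_eq_fderiv hQs, ← pdu_eq_fderiv hk1,
      ← pdu_eq_fderiv hQ1, huv, hk0, h21]
    ring
  have hyuv : pdu (pdv y) (0, 0) = a 1 2 / κ₂ ^ 2 * κ₂ + -1 / κ₂ * a 1 2 := by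
    rw [pdu_pdv_eq_fderiv hys, hyy, ← pdu_pdv_eq_fderiv hQs, ← pdu_eq_fderiv hk1,
      ← pdu_eq_fderiv hQ1, ← pdv_eq_fderiv hk1, ← pdv_eq_fderiv hQ1, huv, hκv, hk0, hku, h12]
    ring
  have hyvv : pdv (pdv y) (0, 0) = 2 * (a 0 3 / κ₂ ^ 2 * κ₂) + -1 / κ₂ * a 0 3 := by
    rw [pdv_pdv_eq_fderiv hys, hyy, ← pdv_pdv_eq_fderiv hQs, ← pdv_eq_fderiv hk1,
      ← pdv_eq_fderiv hQ1, hκv, hk0, hkv, h03]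
    ring
  have hEuu : pdu (pdu (evolutoid α f)) (0, 0) 1 = pdu (pdu y) (0, 0) := by
    rw [hE, (pdu_vec_eventuallyEq hxs hys hzs).pdu_eq,
      (pdu_vec_eventuallyEq hxs.pdu hys.pdu hzs.pdu).self_of_nhds]
    rfl
  have hEuv : pdu (pdv (evolutoid α f)) (0, 0) 1 = pdu (pdv y) (0, 0) := by
    rw [hE, (pdv_vec_eventuallyEq hxs hys hzs).pdu_eq,
      (pdu_vec_eventuallyEq hxs.pdv hys.pdv hzs.pdv).self_of_nhds]
    rfl
  have hEvv : pdv (pdv (evolutoid α f)) (0, 0) 1 = pdv (pdv y) (0, 0) := by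
    rw [hE, (pdv_vec_eventuallyEq hxs hys hzs).pdv_eq,
      (pdv_vec_eventuallyEq hxs.pdv hys.pdv hzs.pdv).self_of_nhds]
    rfl
  have hcr : cross3 (pdu (evolutoid α f) (0, 0)) (pdv (evolutoid α f) (0, 0)) =
      ![0, pdv x (0, 0) * pdu z (0, 0) - pdu x (0, 0) * pdv z (0, 0), 0] := by
    rw [hEu, hEv]
    simp [cross3, mul_comm]
  obtain ⟨m, hm, hN⟩ : ∃ m : ℝ, m ≠ 0 ∧ unitNormal (evolutoid α f) (0, 0) = ![0, m, 0] := by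
    generalize pdv x (0, 0) * pdu z (0, 0) - pdu x (0, 0) * pdv z (0, 0) = d at hdet hcr
    refine ⟨|d|⁻¹ * d, mul_ne_zero (inv_ne_zero (abs_ne_zero.2 hdet)) hdet, ?_⟩
    have hn : norm3 ![0, d, 0] = |d| := by simp [norm3, dot3, Real.sqrt_mul_self_eq_abs]
    rw [unitNormal, hcr, hn]
    simp
  refine ⟨⟨(pdv x (0, 0) / (pdv x (0, 0) * pdu z (0, 0) - pdu x (0, 0) * pdv z (0, 0)),
    -pdu x (0, 0) / (pdv x (0, 0) * pdu z (0, 0) - pdu x (0, 0) * pdv z (0, 0))), ?_⟩, ?_⟩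
  · rw [hEu, hEv]
    ext i
    fin_cases i <;> simp <;> field_simp <;> ring
  rintro ⟨w₁, w₂⟩ hw ⟨c, hwc⟩
  have hw0 : w₁ * pdu x (0, 0) + w₂ * pdv x (0, 0) = 0 := by
    have h := congrFun hwc 0
    rw [hEu, hEv] at h
    simpa using h
  have hdir : a 0 3 * w₂ = w₁ * (κ₂ * (κ₂ - κ₁) * tan α - a 1 2) := by
    rw [hxu, hxv, hlu, hlv] at hw0
    rw [tan_eq_sin_div_cos]
    field_simp at hw0 ⊢
    linear_combination -hw0
  have hw₁ : w₁ ≠ 0 := by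
    rintro rfl
    have h : w₂ = 0 := by simpa [ha03] using hdir
    exact hw (by rw [h]; rfl)
  have hform : dot3 (w₁ ^ 2 • pdu (pdu (evolutoid α f)) (0, 0) +
      (2 * w₁ * w₂) • pdu (pdv (evolutoid α f)) (0, 0) +
      w₂ ^ 2 • pdv (pdv (evolutoid α f)) (0, 0)) (unitNormal (evolutoid α f) (0, 0)) =
      (m / κ₂) * (a 0 3 * w₂ ^ 2 - a 2 1 * w₁ ^ 2) := by
    rw [hN]
    simp [dot3, hEuu, hEuv, hEvv, hyuu, hyuv, hyvv]
    field_simp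
    ring
  have hkey : a 0 3 * (a 0 3 * w₂ ^ 2 - a 2 1 * w₁ ^ 2) =
      w₁ ^ 2 * ((a 1 2 - κ₂ * (κ₂ - κ₁) * tan α) ^ 2 - a 0 3 * a 2 1) := by
    linear_combination (a 0 3 * w₂ + w₁ * (κ₂ * (κ₂ - κ₁) * tan α - a 1 2)) * hdir
  change dot3 (w₁ ^ 2 • _ + (2 * w₁ * w₂) • _ + w₂ ^ 2 • _) _ = 0 ↔ _
  rw [hform, mul_eq_zero_iff_left (div_ne_zero hm hκ₂), ← mul_eq_zero_iff_left ha03, hkey,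
    mul_eq_zero_iff_left (pow_ne_zero 2 hw₁), sub_eq_zero, eq_comm]
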